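/- Let A(Γ₀) be a dihedral Artin-Tits group with generating set S = {s,t}, and let w be any word over S ∪ S⁻¹. Then there exists a geodesic word w' such that w̄ = w̄' and w →_{0,1,2⋆} w'. -/

import Mathlib

namespace ArtinTits

open Classical List

variable {S : Type*}

/-- A word over `S ∪ S⁻¹`: a list of letters, each a generator together with a sign
(`true` = the generator itself, `false` = its formal inverse). -/
abbrev Word (S : Type*) := List (S × Bool)

/-- The formal inverse of a word. -/
def wordInv (w : Word S) : Word S := w.reverse.map fun l => (l.1, !l.2)

/-- `[x,y,j⟩`: the alternating positive word `xyxy⋯` with `j` letters, beginning with `x`. -/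
def altWord (x y : S) : ℕ → Word S
  | 0 => []
  | j + 1 => (x, true) :: altWord y x j

/-- `⟨x,y,j]`: the alternating positive word `⋯xy` with `j` letters, ending with `y`. -/
def altWordR (x y : S) (j : ℕ) : Word S := (altWord y x j).reverse

/-- The data of a labelled finite complete simplicial graph `Γ₀`: a symmetric label map
with values in `{2,3,…} ∪ {∞}` on pairs of distinct vertices. -/
structure ArtinData (S : Type*) where
  m : S → S → ℕ∞
  symm : ∀ s t, m s t = m t s
  two_le : ∀ s t : S, s ≠ t → 2 ≤ m s t

/-- `u = v` is a defining (braid) relation of the Artin–Tits presentation. -/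
def IsRel (A : ArtinData S) (u v : Word S) : Prop :=
  ∃ (s t : S) (k : ℕ), s ≠ t ∧ A.m s t = (k : ℕ∞) ∧
    u = altWord s t k ∧ v = altWord t s k

/-- The relator set of the Artin–Tits presentation, inside the free group. -/
def rels (A : ArtinData S) : Set (FreeGroup S) :=
  {x | ∃ u v : Word S, IsRel A u v ∧ x = FreeGroup.mk u * (FreeGroup.mk v)⁻¹}

/-- The Artin–Tits group `A(Γ₀)` of the presentation. -/
abbrev ArtinGroup (A : ArtinData S) := PresentedGroup (rels A)

/-- `w̄`: the element of the Artin–Tits group represented by the word `w`. -/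
def wbar (A : ArtinData S) (w : Word S) : ArtinGroup A :=
  PresentedGroup.mk (rels A) (FreeGroup.mk w)

/-! ### Special transformations -/

/-- Type 0: delete a factor `s s⁻¹` or `s⁻¹ s`. -/
def Step0 (w w' : Word S) : Prop :=
  ∃ (w₁ w₂ : Word S) (s : S) (b : Bool),
    w = w₁ ++ [(s, b), (s, !b)] ++ w₂ ∧ w' = w₁ ++ w₂

/-- Type ∞: insert a factor `s s⁻¹` or `s⁻¹ s` (the inverse of type 0). -/
def StepInfty (w w' : Word S) : Prop := Step0 w' w

/-- Type 1: replace a factor `v` by `u`, or `v⁻¹` by `u⁻¹`, where `u = v` is a defining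
relation. -/
def Step1 (A : ArtinData S) (w w' : Word S) : Prop :=
  ∃ (w₁ w₂ u v : Word S), IsRel A u v ∧
    ((w = w₁ ++ v ++ w₂ ∧ w' = w₁ ++ u ++ w₂) ∨
     (w = w₁ ++ wordInv v ++ w₂ ∧ w' = w₁ ++ wordInv u ++ w₂))

/-- Type 2r: for a defining relation `u₁u₂ = v₁v₂` with `u₁, v₁` non-empty, replace a factor
`v₁⁻¹ u₁` by `v₂ u₂⁻¹`. -/
def Step2r (A : ArtinData S) (w w' : Word S) : Prop :=
  ∃ (w₁ w₂ u₁ u₂ v₁ v₂ : Word S), IsRel A (u₁ ++ u₂) (v₁ ++ v₂) ∧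
    u₁ ≠ [] ∧ v₁ ≠ [] ∧
    w = w₁ ++ wordInv v₁ ++ u₁ ++ w₂ ∧ w' = w₁ ++ v₂ ++ wordInv u₂ ++ w₂

/-- Type 2l: for a defining relation `u₁u₂ = v₁v₂` with `u₂, v₂` non-empty, replace a factor
`v₂ u₂⁻¹` by `v₁⁻¹ u₁`. -/
def Step2l (A : ArtinData S) (w w' : Word S) : Prop :=
  ∃ (w₁ w₂ u₁ u₂ v₁ v₂ : Word S), IsRel A (u₁ ++ u₂) (v₁ ++ v₂) ∧
    u₂ ≠ [] ∧ v₂ ≠ [] ∧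
    w = w₁ ++ v₂ ++ wordInv u₂ ++ w₂ ∧ w' = w₁ ++ wordInv v₁ ++ u₁ ++ w₂

/-- Type 2: a type 2r or type 2l transformation. -/
def Step2 (A : ArtinData S) (w w' : Word S) : Prop := Step2r A w w' ∨ Step2l A w w'

/-- `p` is the greatest (longest) common left factor of `x` and `y`. -/
def IsLCPrefix (p x y : Word S) : Prop :=
  p <+: x ∧ p <+: y ∧ ∀ q : Word S, q <+: x → q <+: y → q.length ≤ p.length

/-- `p` is the greatest (longest) common right factor of `x` and `y`. -/
def IsLCSuffix (p x y : Word S) : Prop :=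
  p <:+ x ∧ p <:+ y ∧ ∀ q : Word S, q <:+ x → q <:+ y → q.length ≤ p.length

/-- Type 2r⋆ : a type 2r transformation `w₁ v⁻¹ v' w₂ → w₁ u (u')⁻¹ w₂` (with `vu = v'u'` a
defining relation) such that `v` is the greatest common left factor of `vu` and `v w₁⁻¹`, and
`v'` is the greatest common left factor of `v'u'` and `v' w₂`. -/
def Step2rStar (A : ArtinData S) (w w' : Word S) : Prop :=
  ∃ (w₁ w₂ v u v' u' : Word S), IsRel A (v ++ u) (v' ++ u') ∧
    v ≠ [] ∧ v' ≠ [] ∧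
    w = w₁ ++ wordInv v ++ v' ++ w₂ ∧
    w' = w₁ ++ u ++ wordInv u' ++ w₂ ∧
    IsLCPrefix v (v ++ u) (v ++ wordInv w₁) ∧
    IsLCPrefix v' (v' ++ u') (v' ++ w₂)

/-- Type 2l⋆ : a type 2l transformation `w₁ v (v')⁻¹ w₂ → w₁ u⁻¹ u' w₂` (with `uv = u'v'` a
defining relation) such that `v` is the greatest common right factor of `uv` and `w₁ v`, and
`v'` is the greatest common right factor of `u'v'` and `w₂⁻¹ v'`. -/
def Step2lStar (A : ArtinData S) (w w' : Word S) : Prop :=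
  ∃ (w₁ w₂ v u v' u' : Word S), IsRel A (u ++ v) (u' ++ v') ∧
    v ≠ [] ∧ v' ≠ [] ∧
    w = w₁ ++ v ++ wordInv v' ++ w₂ ∧
    w' = w₁ ++ wordInv u ++ u' ++ w₂ ∧
    IsLCSuffix v (u ++ v) (w₁ ++ v) ∧
    IsLCSuffix v' (u' ++ v') (wordInv w₂ ++ v')

/-- Type 2⋆ : a type 2r⋆ or type 2l⋆ transformation. -/
def Step2Star (A : ArtinData S) (w w' : Word S) : Prop :=
  Step2rStar A w w' ∨ Step2lStar A w w'

/-- `w →_{0,1,2} w'`. -/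
def Steps012 (A : ArtinData S) : Word S → Word S → Prop :=
  Relation.ReflTransGen fun x y => Step0 x y ∨ Step1 A x y ∨ Step2 A x y

/-- `w →_{0,1,2⋆} w'`. -/
def Steps012Star (A : ArtinData S) : Word S → Word S → Prop :=
  Relation.ReflTransGen fun x y => Step0 x y ∨ Step1 A x y ∨ Step2Star A x y

/-- `w →_{2⋆} w'`. -/
def Steps2Star (A : ArtinData S) : Word S → Word S → Prop :=
  Relation.ReflTransGen (Step2Star A)

/-- `w →_{1,2⋆} w'`. -/
def Steps12Star (A : ArtinData S) : Word S → Word S → Prop :=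
  Relation.ReflTransGen fun x y => Step1 A x y ∨ Step2Star A x y

/-- `w →_{1,2} w'`. -/
def Steps12 (A : ArtinData S) : Word S → Word S → Prop :=
  Relation.ReflTransGen fun x y => Step1 A x y ∨ Step2 A x y

/-! ### Classes of words -/

/-- A positive word: written over `S`. -/
def Positive (w : Word S) : Prop := ∀ l ∈ w, l.2 = true

/-- A negative word: written over `S⁻¹`. -/
def Negative (w : Word S) : Prop := ∀ l ∈ w, l.2 = false

/-- A signed word: positive or negative. -/
def Signed (w : Word S) : Prop := Positive w ∨ Negative w

/-- An unsigned word: neither positive nor negative. -/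
def Unsigned (w : Word S) : Prop := ¬ Positive w ∧ ¬ Negative w

/-- A freely reduced word: no factor `s s⁻¹` or `s⁻¹ s`. -/
def FreelyReduced (w : Word S) : Prop :=
  ∀ (w₁ w₂ : Word S) (s : S) (b : Bool), w ≠ w₁ ++ [(s, b), (s, !b)] ++ w₂

/-- A square-free word: no factor `aa`. -/
def SquareFree (w : Word S) : Prop := ∀ a : S × Bool, ¬ [a, a] <:+: w

/-- `p̃(w)`: the length of the longest square-free positive factor of `w`. -/
noncomputable def ptilde (w : Word S) : ℕ :=
  sSup {n | ∃ v : Word S, v <:+: w ∧ Positive v ∧ SquareFree v ∧ v.length = n}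

/-- `ñ(w)`: the length of the longest negative factor of `w` whose formal inverse is
square-free. -/
noncomputable def ntilde (w : Word S) : ℕ :=
  sSup {n | ∃ v : Word S, v <:+: w ∧ Negative v ∧ SquareFree (wordInv v) ∧ v.length = n}

/-- `p(w) = min(p̃(w), m)`. -/
noncomputable def pfun (M : ℕ) (w : Word S) : ℕ := min (ptilde w) M

/-- `n(w) = min(ñ(w), m)`. -/
noncomputable def nfun (M : ℕ) (w : Word S) : ℕ := min (ntilde w) M

/-- `Ω(Γ₀)` (for a dihedral presentation with label `M`): the freely reduced words with
`max(p(w), n(w)) < M`. -/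
def Omega (M : ℕ) (w : Word S) : Prop :=
  FreelyReduced w ∧ max (pfun M w) (nfun M w) < M

/-- A signed square-free word (square-free positive, or negative with square-free inverse). -/
def SignedSF (w : Word S) : Prop :=
  (Positive w ∧ SquareFree w) ∨ (Negative w ∧ SquareFree (wordInv w))

/-- `v` is the maximal square-free signed left factor of `w`. -/
def MaxSignedSFPrefix (v w : Word S) : Prop :=
  v <+: w ∧ SignedSF v ∧ ∀ v' : Word S, v' <+: w → SignedSF v' → v'.length ≤ v.length

/-- `(v₁, …, v_k)` is the `⋆`-decomposition of `w`: the `v_i` are non-empty, `w = v₁⋯v_k`,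
and each `v_i` is the maximal square-free signed left factor of `v_i⋯v_k`. -/
def StarDecomp (w : Word S) (L : List (Word S)) : Prop :=
  w = L.flatten ∧ (∀ v ∈ L, v ≠ ([] : Word S)) ∧
    ∀ i (h : i < L.length), MaxSignedSFPrefix (L.get ⟨i, h⟩) ((L.drop i).flatten)

/-! ### Groups, parabolic subgroups, geodesics -/

/-- A word written over `T ∪ T⁻¹` for a subset `T` of the generators. -/
def WordOver (T : Set S) (w : Word S) : Prop := ∀ l ∈ w, l.1 ∈ T

/-- The standard parabolic subgroup `A_T` generated by the image of `T ⊆ S`. -/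
def parab (A : ArtinData S) (T : Set S) : Subgroup (ArtinGroup A) :=
  Subgroup.closure {x | ∃ s ∈ T, x = wbar A [(s, true)]}

/-- A geodesic word: of minimal length among all words representing the same element. -/
def Geodesic (A : ArtinData S) (w : Word S) : Prop :=
  ∀ w' : Word S, wbar A w' = wbar A w → w.length ≤ w'.length

/-- A word over `T ∪ T⁻¹` that is geodesic among the words over `T ∪ T⁻¹` representing the
same element. -/
def GeodesicOver (A : ArtinData S) (T : Set S) (w : Word S) : Prop :=
  WordOver T w ∧
    ∀ w' : Word S, WordOver T w' → wbar A w' = wbar A w → w.length ≤ w'.length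

/-- The length of a group element: the length of any geodesic representative word. -/
noncomputable def elLength (A : ArtinData S) (g : ArtinGroup A) : ℕ :=
  sInf {n | ∃ w : Word S, wbar A w = g ∧ w.length = n}

/-- A positive element: one represented by a positive word. -/
def IsPosElt (A : ArtinData S) (g : ArtinGroup A) : Prop :=
  ∃ w : Word S, Positive w ∧ wbar A w = g

/-- An `H`-transversal: a subset containing `1` and exactly one element of each left
`H`-coset. -/
def IsLeftTransversal {G : Type*} [Group G] (H : Subgroup G) (T : Set G) : Prop :=
  (1 : G) ∈ T ∧ ∀ g : G, ∃! x, x ∈ T ∧ g⁻¹ * x ∈ H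

/-! ### Properties H, H⁺, H# -/

/-- Property `H`: `w →_{0,1,2} ε ↔ w̄ = 1`. -/
def PropertyH (A : ArtinData S) : Prop :=
  ∀ w : Word S, Steps012 A w [] ↔ wbar A w = 1

/-- Property `H⁺`: every word representing an element of a standard parabolic subgroup
`A_{S₀}` can be transformed by `→_{0,1,2⋆}` into a word over `S₀ ∪ S₀⁻¹`. -/
def PropertyHPlus (A : ArtinData S) : Prop :=
  ∀ (S₀ : Set S) (w : Word S), wbar A w ∈ parab A S₀ →
    ∃ w₀ : Word S, WordOver S₀ w₀ ∧ Steps012Star A w w₀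

/-- Property `H#` with respect to an `S`-sequence of transversals `T`. -/
def PropertyHSharpWrt (A : ArtinData S) (T : Set S → Set (ArtinGroup A)) : Prop :=
  (∀ S₀ : Set S, IsLeftTransversal (parab A S₀) (T S₀)) ∧
    ∀ (S' S₀ : Set S) (w : Word S), wbar A w ∈ parab A S' →
      ∃ v u : Word S, WordOver S' v ∧ WordOver (S' ∩ S₀) u ∧
        Steps012 A w (v ++ u) ∧ wbar A v ∈ T S₀

/-- Property `H#`: property `H#` with respect to some `S`-sequence of transversals. -/
def PropertyHSharp (A : ArtinData S) : Prop :=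
  ∃ T : Set S → Set (ArtinGroup A), PropertyHSharpWrt A T

/-! ### Critical words and the involution τ (relative to a dihedral pair) -/

/-- The permutation `δ` induced by conjugation by `Δ`, extended letterwise to words:
the identity if `M` is even, and the swap of `s` and `t` if `M` is odd. -/
noncomputable def deltaMap (s t : S) (M : ℕ) (w : Word S) : Word S :=
  if Even M then w
  else w.map fun l => (if l.1 = s then t else if l.1 = t then s else l.1, l.2)

/-- `w` is an unsigned critical word (of the dihedral pair `{s,t}` with label `M`) and
`w' = τ(w)`. -/
def UCritTauPair (A : ArtinData S) (s t : S) (M : ℕ) (w w' : Word S) : Prop :=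
  WordOver {s, t} w ∧ FreelyReduced w ∧ Unsigned w ∧ GeodesicOver A {s, t} w ∧
  pfun M w + nfun M w = M ∧
  ∃ (x y z z' : S) (wm : Word S),
    ({x, y} : Set S) = {s, t} ∧ ({z, z'} : Set S) = {s, t} ∧
    ((w = altWord x y (pfun M w) ++ wm ++ wordInv (altWord z z' (nfun M w)) ∧
      w' = wordInv (altWordR x y (nfun M w)) ++ deltaMap s t M wm ++
        altWordR z z' (pfun M w)) ∨
     (w = wordInv (altWordR x y (nfun M w)) ++ wm ++ altWordR z z' (pfun M w) ∧
      w' = altWord x y (pfun M w) ++ deltaMap s t M wm ++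
        wordInv (altWord z z' (nfun M w))))

/-- `w` is a positive critical word (of the dihedral pair `{s,t}` with label `M`) and
`w' = τ(w)`. -/
def PosCritTauPair (A : ArtinData S) (s t : S) (M : ℕ) (w w' : Word S) : Prop :=
  WordOver {s, t} w ∧ Positive w ∧ pfun M w = M ∧
  ∃ (x y : S) (wm : Word S), ({x, y} : Set S) = {s, t} ∧ pfun M wm < M ∧
    ((w = altWord x y M ++ wm ∧
      (w' = deltaMap s t M wm ++ altWordR x y M ∨
       w' = deltaMap s t M wm ++ altWordR y x M) ∧
      w'.getLast? ≠ w.getLast?) ∨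
     (w = wm ++ altWordR x y M ∧
      (w' = altWord x y M ++ deltaMap s t M wm ∨
       w' = altWord y x M ++ deltaMap s t M wm) ∧
      w'.head? ≠ w.head?))

/-- `w` is a negative critical word and `w' = τ(w)` (defined via formal inverses). -/
def NegCritTauPair (A : ArtinData S) (s t : S) (M : ℕ) (w w' : Word S) : Prop :=
  PosCritTauPair A s t M (wordInv w) (wordInv w')

/-- `w` is a critical word (unsigned, positive or negative) and `w' = τ(w)`. -/
def CritTauPair (A : ArtinData S) (s t : S) (M : ℕ) (w w' : Word S) : Prop :=
  UCritTauPair A s t M w w' ∨ PosCritTauPair A s t M w w' ∨ NegCritTauPair A s t M w w'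

/-- A type β transformation relative to the dihedral pair `{s,t}` with label `M`:
replace a critical factor `v` by `τ(v)`. -/
def StepBetaPair (A : ArtinData S) (s t : S) (M : ℕ) (w w' : Word S) : Prop :=
  ∃ (w₁ w₂ v v' : Word S), w = w₁ ++ v ++ w₂ ∧ w' = w₁ ++ v' ++ w₂ ∧
    CritTauPair A s t M v v'

/-- A type β transformation (in an Artin–Tits group): a type β transformation relative to some
dihedral standard parabolic subgroup (a pair of generators with finite label). -/
def StepBeta (A : ArtinData S) (w w' : Word S) : Prop :=
  ∃ (s t : S) (M : ℕ), s ≠ t ∧ A.m s t = (M : ℕ∞) ∧ StepBetaPair A s t M w w'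

/-! ### Restriction, direct products, Coxeter graph notions -/

/-- The Artin–Tits presentation induced on a subset `T` of the generators (the presentation of
the standard parabolic subgroup `A_T`). -/
def ArtinData.restrict (A : ArtinData S) (T : Set S) : ArtinData T where
  m a b := A.m a b
  symm a b := A.symm a b
  two_le a b h := A.two_le a b fun h' => h (Subtype.ext h')

/-- The Artin–Tits presentation on the disjoint union `S₁ ⊕ S₂` obtained from presentations on
`S₁` and `S₂` by adding the commuting relations `s₁s₂ = s₂s₁` (label `2`) for `s₁ ∈ S₁`,
`s₂ ∈ S₂`. -/
def prodData {S₁ S₂ : Type*} (A₁ : ArtinData S₁) (A₂ : ArtinData S₂) :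
    ArtinData (S₁ ⊕ S₂) where
  m x y :=
    match x, y with
    | Sum.inl a, Sum.inl b => A₁.m a b
    | Sum.inr a, Sum.inr b => A₂.m a b
    | _, _ => 2
  symm x y := by
    cases x <;> cases y
    · exact A₁.symm _ _
    · rfl
    · rfl
    · exact A₂.symm _ _
  two_le x y h := by
    cases x <;> cases y
    · exact A₁.two_le _ _ fun h' => h (congrArg Sum.inl h')
    · exact le_rfl
    · exact le_rfl
    · exact A₂.two_le _ _ fun h' => h (congrArg Sum.inr h')

/-- Adjacency in the Coxeter graph `Γ` restricted to `T`: distinct vertices of `T` joined by an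
edge (i.e. with label `≠ 2`, edges labelled `2` being removed in `Γ`). -/
def coxAdj (A : ArtinData S) (T : Set S) (x y : S) : Prop :=
  x ∈ T ∧ y ∈ T ∧ x ≠ y ∧ A.m x y ≠ 2

/-- The full subgraph of the Coxeter graph on the vertex subset `T` is connected. -/
def CoxConnected (A : ArtinData S) (T : Set S) : Prop :=
  ∀ x ∈ T, ∀ y ∈ T, Relation.ReflTransGen (coxAdj A T) x y

/-- The relator set of the Coxeter presentation on `T`: the Artin relations together with the
squares of the generators. -/
def coxRels (A : ArtinData S) (T : Set S) : Set (FreeGroup T) :=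
  rels (A.restrict T) ∪ {g | ∃ x : T, g = FreeGroup.of x * FreeGroup.of x}

/-- The induced presentation on `T` is of spherical type: its Coxeter group is finite. -/
def SphericalType (A : ArtinData S) (T : Set S) : Prop :=
  Finite (PresentedGroup (coxRels A T))

/-- The induced presentation on `T` is of large type: all labels are `≥ 3` (possibly `∞`). -/
def LargeTypeOn (A : ArtinData S) (T : Set S) : Prop :=
  ∀ x ∈ T, ∀ y ∈ T, x ≠ y → 3 ≤ A.m x y

/-! ### Alternating words over a pair of generators -/

/-- The generator named by a Boolean: `s` for `true` and `t` for `false`. -/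
def gen (s t : S) (z : Bool) : S := bif z then s else t

/-- The alternating word with `n` letters of sign `b`, beginning with `gen s t z`. -/
def alt (s t : S) (z b : Bool) : ℕ → Word S
  | 0 => []
  | n + 1 => (gen s t z, b) :: alt s t (!z) b n

lemma gen_injective {s t : S} (hst : s ≠ t) {z z' : Bool} (h : gen s t z = gen s t z') :
    z = z' := by
  cases z <;> cases z' <;> simp_all [gen, eq_comm]

lemma exists_gen {s t : S} (hdih : ∀ x : S, x = s ∨ x = t) (x : S) : ∃ z, x = gen s t z := by
  rcases hdih x with rfl | rfl
  · exact ⟨true, rfl⟩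
  · exact ⟨false, rfl⟩

lemma altWord_gen (s t : S) (z : Bool) (n : ℕ) :
    altWord (gen s t z) (gen s t !z) n = alt s t z true n := by
  induction n generalizing z with
  | zero => rfl
  | succ n ih => simpa [altWord, alt] using ih (!z)

@[simp] lemma length_alt (s t : S) (z b : Bool) (n : ℕ) : (alt s t z b n).length = n := by
  induction n generalizing z with
  | zero => rfl
  | succ n ih => simp [alt, ih]

lemma alt_add (s t : S) (z b : Bool) (m n : ℕ) :
    alt s t z b (m + n) = alt s t z b m ++ alt s t (z ^^ m.bodd) b n := by
  induction m generalizing z with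
  | zero => simp [alt]
  | succ m ih =>
    rw [Nat.succ_add]
    simp only [alt, ih, List.cons_append]
    cases z <;> simp

lemma wordInv_append (u v : Word S) : wordInv (u ++ v) = wordInv v ++ wordInv u := by
  simp [wordInv]

lemma wordInv_alt (s t : S) (z b : Bool) (n : ℕ) :
    wordInv (alt s t z b n) = alt s t (z ^^ !n.bodd) (!b) n := by
  induction n generalizing z with
  | zero => rfl
  | succ n ih =>
    rw [alt_add s t (z ^^ !(n + 1).bodd) _ n 1]
    have : alt s t z b (n + 1) = [(gen s t z, b)] ++ alt s t (!z) b n := rfl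
    rw [this, wordInv_append, ih]
    cases z <;> cases h : n.bodd <;> simp [h, wordInv, alt]

lemma isRel_iff_alt (A : ArtinData S) {s t : S} (hst : s ≠ t) (hdih : ∀ x : S, x = s ∨ x = t)
    {M : ℕ} (hM : A.m s t = M) {u v : Word S} :
    IsRel A u v ↔ ∃ z, u = alt s t z true M ∧ v = alt s t (!z) true M := by
  constructor
  · rintro ⟨x, y, k, hxy, hk, rfl, rfl⟩
    obtain ⟨z, rfl⟩ := exists_gen hdih x
    obtain ⟨z', rfl⟩ := exists_gen hdih y
    obtain rfl : z' = !z := by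
      cases z <;> cases z' <;> simp_all
    have hkM : k = M := by
      cases z
      · simpa [gen, A.symm t s, hM, eq_comm] using hk
      · simpa [gen, hM, eq_comm] using hk
    subst hkM
    refine ⟨z, altWord_gen s t z k, ?_⟩
    simpa using altWord_gen s t (!z) k
  · rintro ⟨z, rfl, rfl⟩
    refine ⟨gen s t z, gen s t !z, M, ?_, ?_, (altWord_gen s t z M).symm, ?_⟩
    · intro h
      simpa using gen_injective hst h
    · cases z <;> simp [gen, A.symm t s, hM]
    · simpa using (altWord_gen s t (!z) M).symm

/-! ### Transformations preserve the represented element -/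

lemma wbar_append (A : ArtinData S) (u v : Word S) :
    wbar A (u ++ v) = wbar A u * wbar A v := by
  rw [wbar, ← FreeGroup.mul_mk, map_mul]; rfl

lemma wbar_wordInv (A : ArtinData S) (u : Word S) : wbar A (wordInv u) = (wbar A u)⁻¹ := by
  rw [wbar, wbar, ← map_inv, FreeGroup.inv_mk]
  simp [wordInv, FreeGroup.invRev]

lemma IsRel.wbar_eq {A : ArtinData S} {u v : Word S} (h : IsRel A u v) :
    wbar A u = wbar A v :=
  PresentedGroup.mk_eq_mk_of_mul_inv_mem ⟨u, v, h, rfl⟩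

lemma Step0.wbar_eq {A : ArtinData S} {w w' : Word S} (h : Step0 w w') :
    wbar A w' = wbar A w := by
  obtain ⟨w₁, w₂, s, b, rfl, rfl⟩ := h
  have : [(s, b), (s, !b)] = [(s, b)] ++ wordInv [(s, b)] := rfl
  simp only [wbar_append, this, wbar_wordInv]
  simp

lemma Step1.wbar_eq {A : ArtinData S} {w w' : Word S} (h : Step1 A w w') :
    wbar A w' = wbar A w := by
  obtain ⟨w₁, w₂, u, v, h, ⟨rfl, rfl⟩ | ⟨rfl, rfl⟩⟩ := h <;>
    simp [wbar_append, wbar_wordInv, h.wbar_eq]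

lemma Step2Star.wbar_eq {A : ArtinData S} {w w' : Word S} (h : Step2Star A w w') :
    wbar A w' = wbar A w := by
  rcases h with ⟨w₁, w₂, v, u, v', u', h, -, -, rfl, rfl, -⟩ |
      ⟨w₁, w₂, v, u, v', u', h, -, -, rfl, rfl, -⟩ <;>
    replace h := h.wbar_eq <;>
    simp only [wbar_append, wbar_wordInv] at h ⊢ <;>
    congr 1 <;> simp only [mul_assoc] <;> congr 1
  · rw [eq_inv_mul_iff_mul_eq, ← mul_assoc, h, mul_assoc, mul_inv_cancel, mul_one]
  · rw [inv_mul_eq_iff_eq_mul, ← mul_assoc, h, mul_assoc, mul_inv_cancel, mul_one]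

lemma Steps012Star.wbar_eq {A : ArtinData S} {w w' : Word S} (h : Steps012Star A w w') :
    wbar A w' = wbar A w := by
  induction h with
  | refl => rfl
  | tail _ h ih =>
    rw [← ih]
    rcases h with h | h | h
    exacts [h.wbar_eq, h.wbar_eq, h.wbar_eq]

/-! ### The action of a dihedral Artin–Tits group on stacks of runs -/

/-- A stack of run lengths (top first), the letter on which the topmost run ends, and a counter
of letters and of powers of the Garside element. -/
abbrev Stack := List ℕ × Bool × ℤ

/-- Multiplication of a stack by the generator `z`, where runs of length `M` are absorbed by the
counter. -/
def Stack.push (M : ℕ) (z : Bool) : Stack → Stack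
  | ([], e, B) => if z = e then ([1], e, B) else ([], !e, B + 1)
  | (c :: L, e, B) =>
    if z = e then (1 :: c :: L, e, B)
    else if c + 1 < M then ((c + 1) :: L, !e, B) else (L, e, B + M)

/-- Multiplication of a stack by the inverse of the generator `z`. -/
def Stack.pop (M : ℕ) (z : Bool) : Stack → Stack
  | ([], e, B) => if z = e then ([], !e, B - 1) else ([M - 1], e, B - M)
  | (c :: L, e, B) =>
    if z = e then if 1 < c then ((c - 1) :: L, !e, B) else (L, e, B)
    else ((M - 1) :: c :: L, e, B - M)

/-- All runs of the stack are non-empty and shorter than `M`. -/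
def Stack.Valid (M : ℕ) (x : Stack) : Prop := ∀ c ∈ x.1, 1 ≤ c ∧ c < M

lemma Stack.Valid.push {M : ℕ} (hM : 2 ≤ M) {x : Stack} (hx : x.Valid M) (z : Bool) :
    (x.push M z).Valid M := by
  obtain ⟨_ | ⟨c, L⟩, e, B⟩ := x <;> simp only [Stack.push] <;> split_ifs <;>
    simp_all [Stack.Valid] <;> omega

lemma Stack.Valid.pop {M : ℕ} (hM : 2 ≤ M) {x : Stack} (hx : x.Valid M) (z : Bool) :
    (x.pop M z).Valid M := by
  obtain ⟨_ | ⟨c, L⟩, e, B⟩ := x <;> simp only [Stack.pop] <;> split_ifs <;>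
    simp_all [Stack.Valid] <;> omega

lemma Stack.Valid.pop_push {M : ℕ} {x : Stack} (hx : x.Valid M) (z : Bool) :
    (x.push M z).pop M z = x := by
  obtain ⟨_ | ⟨c, L⟩, e, B⟩ := x
  · by_cases h : z = e <;> cases z <;> cases e <;> simp_all [Stack.push, Stack.pop]
  · have hc := hx c (by simp)
    by_cases h : z = e
    · simp [h, Stack.push, Stack.pop]
    · have h' : z = !e := by cases z <;> cases e <;> simp_all
      by_cases hcM : c + 1 < M
      · have : c ≠ 0 := by omega
        simp [h', hcM, Stack.push, Stack.pop, Nat.pos_iff_ne_zero, this]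
      · obtain rfl : M = c + 1 := by omega
        cases L <;> simp [h', Stack.push, Stack.pop]

lemma Stack.Valid.push_pop {M : ℕ} (hM : 2 ≤ M) {x : Stack} (hx : x.Valid M) (z : Bool) :
    (x.pop M z).push M z = x := by
  have hM' : ¬ M - 1 + 1 < M := by omega
  obtain ⟨_ | ⟨c, L⟩, e, B⟩ := x
  · by_cases h : z = e
    · simp [h, Stack.push, Stack.pop]
    · simp [h, hM', Stack.push, Stack.pop]
  · have hc := hx c (by simp)
    by_cases h : z = e
    · by_cases hc1 : 1 < c
      · have : c - 1 + 1 = c := by omega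
        simp [h, hc1, this, hc.2, Stack.push, Stack.pop]
      · obtain rfl : c = 1 := by omega
        cases L <;> simp [h, Stack.push, Stack.pop]
    · simp [h, hM', Stack.push, Stack.pop]

/-- Multiplication by a generator as a permutation of the valid stacks. -/
def Stack.perm {M : ℕ} (hM : 2 ≤ M) (z : Bool) : Equiv.Perm {x : Stack // x.Valid M} where
  toFun x := ⟨x.1.push M z, x.2.push hM z⟩
  invFun x := ⟨x.1.pop M z, x.2.pop hM z⟩
  left_inv x := Subtype.ext (x.2.pop_push z)
  right_inv x := Subtype.ext (x.2.push_pop hM z)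

/-- Multiplication of a stack by a word, one letter after the other. -/
noncomputable def Stack.act (M : ℕ) (s : S) : Stack → Word S → Stack :=
  List.foldl fun x a => bif a.2 then x.push M (decide (a.1 = s)) else x.pop M (decide (a.1 = s))

namespace Stack

variable {M : ℕ} {s t : S}

@[simp] lemma act_nil (x : Stack) : x.act M s ([] : Word S) = x := rfl

lemma act_append (x : Stack) (u v : Word S) :
    x.act M s (u ++ v) = (x.act M s u).act M s v := by
  simp [act]

lemma act_gen_true (hst : s ≠ t) (x : Stack) (z : Bool) (w : Word S) :
    x.act M s ((gen s t z, true) :: w) = (x.push M z).act M s w := by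
  cases z <;> simp [act, gen, hst.symm]

lemma act_gen_false (hst : s ≠ t) (x : Stack) (z : Bool) (w : Word S) :
    x.act M s ((gen s t z, false) :: w) = (x.pop M z).act M s w := by
  cases z <;> simp [act, gen, hst.symm]

lemma act_alt_extend (hst : s ≠ t) (L : List ℕ) (B : ℤ) (n c : ℕ) (e : Bool) (h : c + n < M) :
    act M s ((c :: L, e, B) : Stack) (alt s t (!e) true n) = ((c + n) :: L, e ^^ n.bodd, B) := by
  induction n generalizing c e with
  | zero => simp [alt]
  | succ n ih =>
    have hc : c + 1 < M := by omega
    rw [alt, act_gen_true hst, push, if_neg (by simp), if_pos hc, ih _ _ (by omega)]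
    cases e <;> simp [Nat.add_assoc, Nat.add_comm 1 n]

lemma act_alt_complete (hst : s ≠ t) (L : List ℕ) (B : ℤ) (n c : ℕ) (e : Bool)
    (h : c + n + 1 = M) :
    act M s ((c :: L, e, B) : Stack) (alt s t (!e) true (n + 1)) = (L, e ^^ n.bodd, B + M) := by
  induction n generalizing c e with
  | zero =>
    have hc : ¬ c + 1 < M := by omega
    simp [alt, act_gen_true hst, push, hc]
  | succ n ih =>
    have hc : c + 1 < M := by omega
    rw [alt, act_gen_true hst, push, if_neg (by simp), if_pos hc, ih _ _ (by omega)]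
    cases e <;> simp

lemma act_alt_bottom (hst : s ≠ t) (B : ℤ) (n : ℕ) (e : Bool) :
    act M s (([], e, B) : Stack) (alt s t (!e) true n) = ([], e ^^ n.bodd, B + n) := by
  induction n generalizing e B with
  | zero => simp [alt]
  | succ n ih =>
    rw [alt, act_gen_true hst, push, if_neg (by simp), ih]
    cases e <;> simp <;> omega

lemma act_alt_positive (hst : s ≠ t) (L : List ℕ) (B : ℤ) {n : ℕ} (e : Bool) (h : 1 ≤ n)
    (hn : n < M) :
    act M s ((L, e, B) : Stack) (alt s t e true n) = (n :: L, e ^^ !n.bodd, B) := by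
  obtain ⟨n, rfl⟩ := Nat.exists_eq_add_of_le' h
  have : push M e ((L, e, B) : Stack) = (1 :: L, e, B) := by cases L <;> simp [push]
  rw [alt, act_gen_true hst, this, act_alt_extend hst _ _ _ _ _ (by omega)]
  simp [Nat.add_comm]

lemma act_alt_shrink (hst : s ≠ t) (L : List ℕ) (B : ℤ) (n c : ℕ) (e : Bool) (h : n < c) :
    act M s ((c :: L, e, B) : Stack) (alt s t e false n) = ((c - n) :: L, e ^^ n.bodd, B) := by
  induction n generalizing c e with
  | zero => simp [alt]
  | succ n ih =>
    have hc : 1 < c := by omega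
    rw [alt, act_gen_false hst, pop, if_pos rfl, if_pos hc, ih _ _ (by omega)]
    cases e <;> simp [Nat.sub_sub, Nat.add_comm]

lemma act_alt_negative (hst : s ≠ t) (L : List ℕ) (B : ℤ) {n : ℕ} (e : Bool) (h : 1 ≤ n)
    (hn : n < M) :
    act M s ((L, e, B) : Stack) (alt s t (!e) false n) =
      ((M - n) :: L, e ^^ !n.bodd, B - M) := by
  obtain ⟨n, rfl⟩ := Nat.exists_eq_add_of_le' h
  have : pop M (!e) ((L, e, B) : Stack) = ((M - 1) :: L, e, B - M) := by
    cases L <;> simp [pop]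
  rw [alt, act_gen_false hst, this, Bool.not_not, act_alt_shrink hst _ _ _ _ _ (by omega)]
  simp [Nat.sub_sub, Nat.add_comm]

lemma Valid.act_garside (hst : s ≠ t) (hM : 2 ≤ M) {L : List ℕ} {e : Bool} {B : ℤ}
    (hx : Valid M ((L, e, B) : Stack)) (z : Bool) :
    act M s ((L, e, B) : Stack) (alt s t z true M) = (L, e ^^ M.bodd, B + M) := by
  by_cases hz : z = e
  · subst hz
    obtain ⟨m, rfl⟩ := Nat.exists_eq_add_of_le' hM
    have : Stack.push (m + 2) z ((L, z, B) : Stack) = (1 :: L, z, B) := by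
      cases L <;> simp [Stack.push]
    rw [alt, act_gen_true hst, this, act_alt_complete hst _ _ _ _ _ (by omega)]
    simp
  · obtain rfl : z = !e := by cases z <;> cases e <;> simp_all
    rcases L with _ | ⟨c, L⟩
    · exact act_alt_bottom hst _ _ _
    · obtain ⟨h1, h2⟩ := hx c (by simp)
      obtain ⟨d, hd⟩ := Nat.exists_eq_add_of_lt h2
      have hsplit : alt s t (!e) true M =
          alt s t (!e) true (d + 1) ++ alt s t (e ^^ d.bodd) true c := by
        rw [show M = (d + 1) + c by omega, alt_add]
        cases e <;> simp
      rw [hsplit, act_append, act_alt_complete hst _ _ _ _ _ hd.symm,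
        act_alt_positive hst _ _ _ h1 h2, hd]
      cases e <;> cases hb : c.bodd <;> cases hb' : d.bodd <;> simp [hb, hb']

end Stack

/-- The generators of a dihedral Artin–Tits group, acting from the right on valid stacks. -/
noncomputable def Stack.permOf (s : S) {M : ℕ} (hM : 2 ≤ M) (x : S) :
    (Equiv.Perm {x : Stack // x.Valid M})ᵐᵒᵖ :=
  MulOpposite.op (Stack.perm hM (decide (x = s)))

lemma Stack.lift_permOf (s : S) {M : ℕ} (hM : 2 ≤ M) (w : Word S)
    (x : {x : Stack // x.Valid M}) :
    ((FreeGroup.lift (Stack.permOf s hM) (FreeGroup.mk w)).unop x).1 = x.1.act M s w := by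
  induction w generalizing x with
  | nil => simp
  | cons a w ih =>
    have : FreeGroup.mk (a :: w) = FreeGroup.mk [a] * FreeGroup.mk w := by
      rw [FreeGroup.mul_mk]; rfl
    rw [this, map_mul, MulOpposite.unop_mul, Equiv.Perm.mul_apply, ih]
    obtain ⟨y, _ | _⟩ := a <;> simp [Stack.act, Stack.permOf] <;> rfl

lemma Stack.act_eq_of_wbar_eq (A : ArtinData S) {s t : S} (hst : s ≠ t)
    (hdih : ∀ x : S, x = s ∨ x = t) {M : ℕ} (hM : A.m s t = M) {w w' : Word S}
    (h : wbar A w = wbar A w') {x : Stack} (hx : x.Valid M) : x.act M s w = x.act M s w' := by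
  have hM2 : 2 ≤ M := by
    have := A.two_le s t hst
    rw [hM] at this
    exact_mod_cast this
  have hrel : ∀ r ∈ rels A, FreeGroup.lift (Stack.permOf s hM2) r = 1 := by
    rintro r ⟨u, v, huv, rfl⟩
    obtain ⟨z, rfl, rfl⟩ := (isRel_iff_alt A hst hdih hM).1 huv
    rw [map_mul, map_inv, mul_inv_eq_one]
    refine MulOpposite.unop_injective (Equiv.ext fun y => Subtype.ext ?_)
    rw [Stack.lift_permOf, Stack.lift_permOf]
    obtain ⟨⟨L, e, B⟩, hy⟩ := y
    exact (hy.act_garside hst hM2 z).trans (hy.act_garside hst hM2 _).symm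
  have key : FreeGroup.lift (Stack.permOf s hM2) (FreeGroup.mk w) =
      FreeGroup.lift (Stack.permOf s hM2) (FreeGroup.mk w') :=
    congrArg (PresentedGroup.toGroup hrel) h
  rw [← Stack.lift_permOf s hM2 w ⟨x, hx⟩, key, Stack.lift_permOf]

/-! ### Length bounds -/

/-- The sum of the signs of the letters, a homomorphism invariant. -/
def Stack.total (x : Stack) : ℤ := (x.1.sum : ℤ) + x.2.2

/-- The contribution of a run of length `c` to the length bound with threshold `θ`. -/
def runWeight (θ c : ℤ) : ℤ := min c (2 * θ - c)

/-- The contribution of the counter to the length bound with threshold `θ`. -/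
def counterWeight (M : ℕ) (θ B : ℤ) : ℤ := runWeight θ (B % M) + (2 * θ - M) * (B / M)

/-- A function on stacks which is `1`-Lipschitz for the action of the generators. -/
def Stack.weight (M : ℕ) (θ : ℤ) (x : Stack) : ℤ :=
  (x.1.map fun c : ℕ => runWeight θ c).sum + counterWeight M θ x.2.2

lemma counterWeight_add_mul {M : ℕ} {θ r q : ℤ} (h0 : 0 ≤ r) (hr : r < M) :
    counterWeight M θ (r + M * q) = runWeight θ r + (2 * θ - M) * q := by
  have : (M : ℤ) ≠ 0 := by omega
  rw [counterWeight, Int.add_mul_emod_self_left, Int.emod_eq_of_lt h0 hr,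
    Int.add_mul_ediv_left _ _ this, Int.ediv_eq_zero_of_lt h0 hr, zero_add]

lemma counterWeight_add {M : ℕ} (hM : 2 ≤ M) (θ B : ℤ) :
    counterWeight M θ (B + M) = counterWeight M θ B + (2 * θ - M) := by
  have hM0 : (M : ℤ) ≠ 0 := by omega
  have h := Int.emod_add_mul_ediv B M
  have h0 := Int.emod_nonneg B hM0
  have h1 := Int.emod_lt_of_pos B (show (0 : ℤ) < M by omega)
  rw [← h, counterWeight_add_mul h0 h1, add_assoc, ← mul_add_one, counterWeight_add_mul h0 h1]
  ring

lemma abs_counterWeight_succ_sub {M : ℕ} (hM : 2 ≤ M) {θ : ℤ} (h0 : 0 ≤ θ) (hθ : θ ≤ M) (B : ℤ) :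
    |counterWeight M θ (B + 1) - counterWeight M θ B| ≤ 1 := by
  have hM0 : (M : ℤ) ≠ 0 := by omega
  have hB := Int.emod_add_mul_ediv B M
  have hr0 := Int.emod_nonneg B hM0
  have hr1 := Int.emod_lt_of_pos B (show (0 : ℤ) < M by omega)
  rw [← hB]
  generalize B % (M : ℤ) = r at hr0 hr1 ⊢
  generalize B / (M : ℤ) = q
  rw [counterWeight_add_mul hr0 hr1]
  by_cases hr : r + 1 < M
  · rw [add_right_comm, counterWeight_add_mul (by omega) hr]
    simp only [add_sub_add_right_eq_sub, runWeight, abs_le]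
    omega
  · obtain rfl : r = M - 1 := by omega
    rw [show (M : ℤ) - 1 + M * q + 1 = 0 + M * (q + 1) by ring,
      counterWeight_add_mul le_rfl (by omega), mul_add_one, runWeight, runWeight, abs_le]
    omega

lemma Stack.Valid.abs_weight_push_sub {M : ℕ} (hM : 2 ≤ M) {θ : ℤ} (h0 : 0 ≤ θ) (hθ : θ ≤ M)
    {x : Stack} (hx : x.Valid M) (z : Bool) :
    |(x.push M z).weight M θ - x.weight M θ| ≤ 1 := by
  obtain ⟨_ | ⟨c, L⟩, e, B⟩ := x
  · have := abs_counterWeight_succ_sub hM h0 hθ B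
    simp only [Stack.push]
    split_ifs <;> simp [Stack.weight, runWeight, abs_le] at this ⊢ <;> omega
  · have hc := hx c (by simp)
    have := counterWeight_add hM θ B
    simp only [Stack.push]
    split_ifs <;> simp [Stack.weight, runWeight, abs_le, this] <;> omega

lemma Stack.Valid.act {M : ℕ} (hM : 2 ≤ M) {x : Stack} (hx : x.Valid M) (s : S) (w : Word S) :
    (x.act M s w).Valid M := by
  induction w generalizing x with
  | nil => exact hx
  | cons a w ih =>
    obtain ⟨y, _ | _⟩ := a
    exacts [ih (hx.pop hM _), ih (hx.push hM _)]

lemma Stack.Valid.weight_act_le {M : ℕ} (hM : 2 ≤ M) {θ : ℤ} (h0 : 0 ≤ θ) (hθ : θ ≤ M)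
    {x : Stack} (hx : x.Valid M) (s : S) (w : Word S) :
    (x.act M s w).weight M θ ≤ x.weight M θ + w.length := by
  induction w generalizing x with
  | nil => simp
  | cons a w ih =>
    obtain ⟨y, _ | _⟩ := a
    · have h1 := ih (hx.pop hM (decide (y = s)))
      have h2 := abs_le.1 ((hx.pop hM (decide (y = s))).abs_weight_push_sub hM h0 hθ
        (decide (y = s)))
      rw [hx.push_pop hM] at h2
      have : x.act M s ((y, false) :: w) = (x.pop M (decide (y = s))).act M s w := rfl
      rw [this]
      push_cast [List.length_cons]
      omega
    · have h1 := ih (hx.push hM (decide (y = s)))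
      have h2 := abs_le.1 (hx.abs_weight_push_sub hM h0 hθ (decide (y = s)))
      have : x.act M s ((y, true) :: w) = (x.push M (decide (y = s))).act M s w := rfl
      rw [this]
      push_cast [List.length_cons]
      omega

lemma Stack.Valid.total_push {M : ℕ} {x : Stack} (hx : x.Valid M) (z : Bool) :
    (x.push M z).total = x.total + 1 := by
  obtain ⟨_ | ⟨c, L⟩, e, B⟩ := x
  · simp only [Stack.push]
    split_ifs <;> (simp [Stack.total]; try omega)
  · have hc := hx c (by simp)
    simp only [Stack.push]
    split_ifs <;> simp [Stack.total] <;> omega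

lemma Stack.Valid.total_act {M : ℕ} (hM : 2 ≤ M) {x : Stack} (hx : x.Valid M) (s : S)
    (w : Word S) :
    (x.act M s w).total = x.total + (w.map fun a => bif a.2 then (1 : ℤ) else -1).sum := by
  induction w generalizing x with
  | nil => simp
  | cons a w ih =>
    obtain ⟨y, _ | _⟩ := a
    · have h2 := (hx.pop hM (decide (y = s))).total_push (decide (y = s))
      rw [hx.push_pop hM] at h2
      have : x.act M s ((y, false) :: w) = (x.pop M (decide (y = s))).act M s w := rfl
      rw [this, ih (hx.pop hM _), h2]
      simp
    · have : x.act M s ((y, true) :: w) = (x.push M (decide (y = s))).act M s w := rfl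
      rw [this, ih (hx.push hM _), hx.total_push]
      simp [add_assoc]

lemma abs_sum_signs_le (w : Word S) :
    |(w.map fun a => bif a.2 then (1 : ℤ) else -1).sum| ≤ w.length := by
  induction w with
  | nil => simp
  | cons a w ih =>
    rw [abs_le] at ih ⊢
    obtain ⟨y, _ | _⟩ := a <;> simp <;> omega

lemma sum_signs_of_signed {w : Word S} (b : Bool) (hw : ∀ a ∈ w, a.2 = b) :
    |(w.map fun a => bif a.2 then (1 : ℤ) else -1).sum| = w.length := by
  have : (w.map fun a => bif a.2 then (1 : ℤ) else -1) =
      List.replicate w.length (bif b then (1 : ℤ) else -1) := by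
    rw [List.eq_replicate_iff]
    refine ⟨by simp, ?_⟩
    simp only [List.mem_map]
    rintro _ ⟨a, ha, rfl⟩
    rw [hw a ha]
  rw [this]
  cases b <;> simp

lemma geodesic_of_signed (A : ArtinData S) {s t : S} (hst : s ≠ t)
    (hdih : ∀ x : S, x = s ∨ x = t) {M : ℕ} (hM : A.m s t = M) (hM2 : 2 ≤ M) {w : Word S}
    {b : Bool} (hw : ∀ a ∈ w, a.2 = b) : Geodesic A w := by
  intro w' h
  have hx : Stack.Valid M (([], true, 0) : Stack) := by simp [Stack.Valid]
  have h1 := congrArg Stack.total (Stack.act_eq_of_wbar_eq A hst hdih hM h hx)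
  rw [hx.total_act hM2, hx.total_act hM2, add_right_inj] at h1
  have h2 := abs_sum_signs_le w'
  rw [h1, sum_signs_of_signed b hw] at h2
  exact_mod_cast h2

/-! ### Words as sequences of signed runs -/

/-- The number of letters of a run: `c` for a positive run, `M - c` for a negative one. -/
def runLength (M : ℕ) (b : Bool) (c : ℕ) : ℕ := bif b then c else M - c

lemma runLength_runLength {M n : ℕ} (hn : n ≤ M) (b : Bool) :
    runLength M b (runLength M b n) = n := by
  cases b <;> simp [runLength]; omega

/-- The word made of the given runs, each given by its sign and its residue; a run begins with
the last letter of the preceding one if the signs agree, and with the inverse of the other letter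
otherwise. -/
def build (s t : S) (M : ℕ) : Bool → List (Bool × ℕ) → Word S
  | _, [] => []
  | x, (b, c) :: R =>
    alt s t (x ^^ !b) b (runLength M b c) ++ build s t M (x ^^ !(runLength M b c).bodd) R

/-- The letter governing what may follow `build s t M x R`. -/
def exitLetter (M : ℕ) : Bool → List (Bool × ℕ) → Bool
  | x, [] => x
  | x, (b, c) :: R => exitLetter M (x ^^ !(runLength M b c).bodd) R

/-- All residues are positive and smaller than `M`. -/
def ValidRuns (M : ℕ) (R : List (Bool × ℕ)) : Prop := ∀ p ∈ R, 1 ≤ p.2 ∧ p.2 < M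

lemma build_append (s t : S) (M : ℕ) (x : Bool) (R R' : List (Bool × ℕ)) :
    build s t M x (R ++ R') = build s t M x R ++ build s t M (exitLetter M x R) R' := by
  induction R generalizing x with
  | nil => rfl
  | cons p R ih => simp [build, exitLetter, ih]

lemma exitLetter_append (M : ℕ) (x : Bool) (R R' : List (Bool × ℕ)) :
    exitLetter M x (R ++ R') = exitLetter M (exitLetter M x R) R' := by
  induction R generalizing x with
  | nil => rfl
  | cons p R ih => simp [exitLetter, ih]

lemma alt_succ_concat (s t : S) (z b : Bool) (n : ℕ) :
    alt s t z b (n + 1) = alt s t z b n ++ [(gen s t (z ^^ n.bodd), b)] :=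
  alt_add s t z b n 1

lemma head?_alt (s t : S) (z b : Bool) {n : ℕ} {a : S × Bool}
    (h : (alt s t z b n).head? = some a) : a = (gen s t z, b) := by
  cases n <;> simp_all [alt]

lemma getLast?_alt (s t : S) (z b : Bool) {n : ℕ} {a : S × Bool}
    (h : (alt s t z b n).getLast? = some a) : a = (gen s t (z ^^ !n.bodd), b) := by
  cases n with
  | zero => simp [alt] at h
  | succ n => rw [alt_succ_concat] at h; simp_all

lemma ValidRuns.runLength_pos {M : ℕ} {R : List (Bool × ℕ)} (hR : ValidRuns M R) {b : Bool}
    {c : ℕ} (h : (b, c) ∈ R) : 1 ≤ runLength M b c ∧ runLength M b c < M := by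
  have := hR _ h
  cases b <;> simp [runLength] at this ⊢ <;> omega

lemma head?_build {s t : S} (hst : s ≠ t) {M : ℕ} {R : List (Bool × ℕ)} (hR : ValidRuns M R)
    (x b : Bool) : (build s t M x R).head? ≠ some (gen s t (x ^^ b), b) := by
  rcases R with _ | ⟨⟨b', c⟩, R⟩
  · simp [build]
  · obtain ⟨n, hn⟩ := Nat.exists_eq_add_of_le' (hR.runLength_pos (List.mem_cons_self)).1
    simp only [build, hn, alt, List.cons_append, List.head?_cons, ne_eq, Option.some.injEq,
      Prod.mk.injEq, not_and]
    intro h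
    have := gen_injective hst h
    cases x <;> cases b <;> cases b' <;> simp_all

lemma getLast?_build {s t : S} (hst : s ≠ t) {M : ℕ} {R : List (Bool × ℕ)} (hR : ValidRuns M R)
    (x b : Bool) :
    (build s t M x R).getLast? ≠ some (gen s t (exitLetter M x R ^^ b), b) := by
  rcases List.eq_nil_or_concat R with rfl | ⟨R, ⟨b', c⟩, rfl⟩
  · simp [build]
  · obtain ⟨n, hn⟩ := Nat.exists_eq_add_of_le'
      (hR.runLength_pos (b := b') (c := c) (by simp)).1
    simp only [List.concat_eq_append, build_append, exitLetter_append, build, exitLetter, hn,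
      alt_succ_concat,
      List.append_nil, ← List.append_assoc, List.getLast?_append, List.getLast?_singleton,
      Option.some_or, ne_eq, Option.some.injEq, Prod.mk.injEq, not_and]
    intro h
    have := gen_injective hst h
    generalize exitLetter M x R = y at this
    cases y <;> cases b <;> cases b' <;> cases hn : n.bodd <;> simp_all

lemma isLCPrefix_append {v u z : Word S} (h : ∀ a, u.head? = some a → z.head? ≠ some a) :
    IsLCPrefix v (v ++ u) (v ++ z) := by
  refine ⟨List.prefix_append _ _, List.prefix_append _ _, fun q hu hz => ?_⟩
  by_contra! hlt
  obtain ⟨r, rfl⟩ := List.prefix_of_prefix_length_le (List.prefix_append v u) hu hlt.le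
  rw [List.prefix_append_right_inj] at hu hz
  rcases r with _ | ⟨a, r⟩
  · simp at hlt
  · obtain ⟨k, rfl⟩ := hu
    obtain ⟨k', rfl⟩ := hz
    exact h a rfl rfl

lemma isLCSuffix_append {v u z : Word S} (h : ∀ a, u.getLast? = some a → z.getLast? ≠ some a) :
    IsLCSuffix v (u ++ v) (z ++ v) := by
  refine ⟨List.suffix_append _ _, List.suffix_append _ _, fun q hu hz => ?_⟩
  by_contra! hlt
  obtain ⟨r, rfl⟩ := List.suffix_of_suffix_length_le (List.suffix_append u v) hu hlt.le
  obtain ⟨k, hk⟩ := hu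
  obtain ⟨k', hk'⟩ := hz
  rw [← List.append_assoc, List.append_cancel_right_eq] at hk hk'
  rcases List.eq_nil_or_concat r with rfl | ⟨r, a, rfl⟩
  · simp at hlt
  · subst hk hk'
    exact h a (by simp) (by simp)

lemma head?_wordInv (w : Word S) : (wordInv w).head? = w.getLast?.map fun a => (a.1, !a.2) := by
  simp [wordInv]

lemma getLast?_wordInv (w : Word S) :
    (wordInv w).getLast? = w.head?.map fun a => (a.1, !a.2) := by
  simp [wordInv]

lemma step2rStar_alt (A : ArtinData S) {s t : S} (hst : s ≠ t) (hdih : ∀ x : S, x = s ∨ x = t)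
    {M : ℕ} (hM : A.m s t = M) {w₁ w₂ : Word S} {x y : Bool} {n c c' d : ℕ} (hn : 1 ≤ n)
    (hc' : 1 ≤ c') (h1 : n + c = M) (h2 : c' + d = M) (hy : y = (x ^^ !n.bodd))
    (hw₁ : w₁.getLast? ≠ some (gen s t x, false))
    (hw₂ : w₂.head? ≠ some (gen s t (y ^^ c'.bodd), true)) :
    Step2rStar A (w₁ ++ (alt s t (!x) false n ++ (alt s t y true c' ++ w₂)))
      (w₁ ++ (alt s t x true c ++ (alt s t (x ^^ c.bodd) false d ++ w₂))) := by
  have hp : c.bodd = (n.bodd ^^ (c'.bodd ^^ d.bodd)) := by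
    rw [← Nat.bodd_add, h2, ← h1, Nat.bodd_add]; simp
  have hvu : alt s t (!y) true n ++ alt s t x true c = alt s t (!y) true M := by
    rw [← h1, alt_add]
    congr 2
    subst hy
    cases x <;> cases n.bodd <;> rfl
  have hvu' : alt s t y true c' ++ alt s t (y ^^ c'.bodd) true d = alt s t y true M := by
    rw [← h2, alt_add]
  refine ⟨w₁, w₂, alt s t (!y) true n, alt s t x true c, alt s t y true c',
    alt s t (y ^^ c'.bodd) true d, ?_, ?_, ?_, ?_, ?_, ?_, ?_⟩
  · rw [hvu, hvu', isRel_iff_alt A hst hdih hM]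
    exact ⟨!y, rfl, by simp⟩
  · rw [← List.length_pos_iff_ne_nil]; simp; omega
  · rw [← List.length_pos_iff_ne_nil]; simp; omega
  · have : (!y ^^ !n.bodd) = !x := by
      subst hy
      cases x <;> cases n.bodd <;> rfl
    simp [wordInv_alt, this]
  · have : (y ^^ c'.bodd ^^ !d.bodd) = (x ^^ c.bodd) := by
      rw [hp]
      subst hy
      cases x <;> cases n.bodd <;> cases c'.bodd <;> cases d.bodd <;> rfl
    simp [wordInv_alt, this]
  · refine isLCPrefix_append fun a ha hz => ?_
    obtain rfl := head?_alt _ _ _ _ ha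
    rw [head?_wordInv, Option.map_eq_some_iff] at hz
    obtain ⟨⟨a, b⟩, ha, hab⟩ := hz
    simp only [Prod.mk.injEq, Bool.not_eq_eq_eq_not, Bool.not_true] at hab
    rw [hab.1, hab.2] at ha
    exact hw₁ ha
  · refine isLCPrefix_append fun a ha hz => ?_
    obtain rfl := head?_alt _ _ _ _ ha
    exact hw₂ hz

lemma step2lStar_alt (A : ArtinData S) {s t : S} (hst : s ≠ t) (hdih : ∀ x : S, x = s ∨ x = t)
    {M : ℕ} (hM : A.m s t = M) {w₁ w₂ : Word S} {x y : Bool} {n c c' d : ℕ} (hc : 1 ≤ c)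
    (hd : 1 ≤ d) (h1 : n + c = M) (h2 : c' + d = M) (hy : y = (x ^^ !c.bodd))
    (hw₁ : w₁.getLast? ≠ some (gen s t (!x), true))
    (hw₂ : w₂.head? ≠ some (gen s t (y ^^ !d.bodd), false)) :
    Step2lStar A (w₁ ++ (alt s t x true c ++ (alt s t (!y) false d ++ w₂)))
      (w₁ ++ (alt s t (!x) false n ++ (alt s t (x ^^ !n.bodd) true c' ++ w₂))) := by
  have hp : c.bodd = (n.bodd ^^ (c'.bodd ^^ d.bodd)) := by
    rw [← Nat.bodd_add, h2, ← h1, Nat.bodd_add]; simp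
  have huv : alt s t (x ^^ n.bodd) true n ++ alt s t x true c =
      alt s t (x ^^ n.bodd) true M := by
    rw [← h1, alt_add]
    congr 2
    cases x <;> cases n.bodd <;> rfl
  have huv' : alt s t (x ^^ !n.bodd) true c' ++ alt s t (y ^^ d.bodd) true d =
      alt s t (x ^^ !n.bodd) true M := by
    rw [← h2, alt_add]
    congr 2
    subst hy
    rw [hp]
    cases x <;> cases n.bodd <;> cases c'.bodd <;> cases d.bodd <;> rfl
  refine ⟨w₁, w₂, alt s t x true c, alt s t (x ^^ n.bodd) true n,
    alt s t (y ^^ d.bodd) true d, alt s t (x ^^ !n.bodd) true c', ?_, ?_, ?_, ?_, ?_, ?_, ?_⟩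
  · rw [huv, huv', isRel_iff_alt A hst hdih hM]
    exact ⟨x ^^ n.bodd, rfl, by simp⟩
  · rw [← List.length_pos_iff_ne_nil]; simp; omega
  · rw [← List.length_pos_iff_ne_nil]; simp; omega
  · have : (y ^^ d.bodd ^^ !d.bodd) = !y := by
      cases y <;> cases d.bodd <;> rfl
    simp only [wordInv_alt, this, List.append_assoc, Bool.not_true]
  · have : (x ^^ n.bodd ^^ !n.bodd) = !x := by
      cases x <;> cases n.bodd <;> rfl
    simp only [wordInv_alt, this, List.append_assoc, Bool.not_true]
  · refine isLCSuffix_append fun a ha hz => ?_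
    obtain rfl := getLast?_alt _ _ _ _ ha
    have : (x ^^ n.bodd ^^ !n.bodd) = !x := by
      cases x <;> cases n.bodd <;> rfl
    rw [this] at hz
    exact hw₁ hz
  · refine isLCSuffix_append fun a ha hz => ?_
    obtain rfl := getLast?_alt _ _ _ _ ha
    have : (x ^^ !n.bodd ^^ !c'.bodd) = (y ^^ !d.bodd) := by
      subst hy
      rw [hp]
      cases x <;> cases n.bodd <;> cases c'.bodd <;> cases d.bodd <;> rfl
    rw [getLast?_wordInv, Option.map_eq_some_iff, this] at hz
    obtain ⟨⟨a, b⟩, ha, hab⟩ := hz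
    simp only [Prod.mk.injEq, Bool.not_eq_eq_eq_not, Bool.not_true] at hab
    rw [hab.1, hab.2] at ha
    exact hw₂ ha

/-- Adjacent runs of opposite signs exchange their signs by a single transformation. -/
lemma step2Star_build (A : ArtinData S) {s t : S} (hst : s ≠ t)
    (hdih : ∀ x : S, x = s ∨ x = t) {M : ℕ} (hM : A.m s t = M) {P Q : List (Bool × ℕ)}
    (hP : ValidRuns M P) (hQ : ValidRuns M Q) {c c' : ℕ} (hc : 1 ≤ c ∧ c < M)
    (hc' : 1 ≤ c' ∧ c' < M) (x b : Bool) :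
    Step2Star A (build s t M x (P ++ (b, c) :: (!b, c') :: Q))
      (build s t M x (P ++ (!b, c) :: (b, c') :: Q)) := by
  rw [build_append, build_append]
  have hlast := getLast?_build hst hP x
  generalize exitLetter M x P = e at hlast ⊢
  have hpar : ((M - c).bodd ^^ c'.bodd) = (c.bodd ^^ (M - c').bodd) := by
    have h1 : ((M - c) + c).bodd = ((M - c') + c').bodd := by congr 1; omega
    rw [Nat.bodd_add, Nat.bodd_add] at h1
    have key : ∀ p q r u : Bool, (p ^^ q) = (r ^^ u) → (p ^^ u) = (q ^^ r) := by decide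
    exact key _ _ _ _ h1
  have hentry : (e ^^ !c.bodd ^^ !(M - c').bodd) = (e ^^ !(M - c).bodd ^^ !c'.bodd) := by
    have key : ∀ e p q r u : Bool, (p ^^ q) = (r ^^ u) → (e ^^ !r ^^ !u) = (e ^^ !p ^^ !q) := by
      decide
    exact key _ _ _ _ _ hpar
  cases b
  · left
    have h := step2rStar_alt A hst hdih hM (w₁ := build s t M x P)
      (w₂ := build s t M (e ^^ !(M - c).bodd ^^ !c'.bodd) Q) (x := e) (n := M - c) (c := c)
      (c' := c') (d := M - c') (by omega) hc'.1 (by omega) (by omega) rfl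
      (by simpa using hlast false) ?_
    · simp only [build, runLength, Bool.not_false, Bool.not_true, cond_true, cond_false, hentry]
      simpa using h
    · have := head?_build hst hQ (e ^^ !(M - c).bodd ^^ !c'.bodd) true
      simpa using this
  · right
    have h := step2lStar_alt A hst hdih hM (w₁ := build s t M x P)
      (w₂ := build s t M (e ^^ !c.bodd ^^ !(M - c').bodd) Q) (x := e) (n := M - c) (c := c)
      (c' := c') (d := M - c') hc.1 (by omega) (by omega) (by omega) rfl
      (by simpa using hlast true) ?_
    · simp only [build, runLength, Bool.not_false, Bool.not_true, cond_true, cond_false,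
        ← hentry]
      simpa using h
    · have := head?_build hst hQ (e ^^ !c.bodd ^^ !(M - c').bodd) false
      simpa using this

lemma ValidRuns.cons {M : ℕ} {R : List (Bool × ℕ)} (hR : ValidRuns M R) {p : Bool × ℕ}
    (hp : 1 ≤ p.2 ∧ p.2 < M) : ValidRuns M (p :: R) :=
  List.forall_mem_cons.2 ⟨hp, hR⟩

lemma ValidRuns.append {M : ℕ} {R R' : List (Bool × ℕ)} (hR : ValidRuns M R)
    (hR' : ValidRuns M R') : ValidRuns M (R ++ R') :=
  List.forall_mem_append.2 ⟨hR, hR'⟩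

lemma validRuns_zip {M : ℕ} {bs : List Bool} {cs : List ℕ} (h : ∀ c ∈ cs, 1 ≤ c ∧ c < M) :
    ValidRuns M (bs.zip cs) :=
  fun _ hp => h _ (List.of_mem_zip hp).2

/-- The signs of the runs may be permuted arbitrarily by transformations of type `2⋆`. -/
lemma steps012Star_build_of_perm (A : ArtinData S) {s t : S} (hst : s ≠ t)
    (hdih : ∀ x : S, x = s ∨ x = t) {M : ℕ} (hM : A.m s t = M) (x : Bool) {bs bs' : List Bool}
    (h : bs ~ bs') {P : List (Bool × ℕ)} {cs : List ℕ} (hlen : bs.length = cs.length)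
    (hP : ValidRuns M P) (hcs : ∀ c ∈ cs, 1 ≤ c ∧ c < M) :
    Steps012Star A (build s t M x (P ++ bs.zip cs)) (build s t M x (P ++ bs'.zip cs)) := by
  induction h generalizing P cs with
  | nil => exact .refl
  | cons b _ ih =>
    rcases cs with _ | ⟨c, cs⟩
    · exact .refl
    · have hc := List.forall_mem_cons.1 hcs
      simpa using ih (P := P ++ [(b, c)]) (by simpa using hlen)
        (hP.append (ValidRuns.cons (by simp [ValidRuns]) hc.1)) hc.2
  | swap b b' bs =>
    rcases cs with _ | ⟨c, _ | ⟨c', cs⟩⟩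
    · exact .refl
    · simp at hlen
    · by_cases hb : b = b'
      · subst hb
        exact .refl
      · obtain rfl : b = !b' := by cases b <;> cases b' <;> simp_all
        obtain ⟨hc, hcs⟩ := List.forall_mem_cons.1 hcs
        obtain ⟨hc', hcs⟩ := List.forall_mem_cons.1 hcs
        exact .single (.inr (.inr
          (step2Star_build A hst hdih hM hP (validRuns_zip hcs) hc hc' x b')))
  | trans h _ ih ih' => exact (ih hlen hP hcs).trans (ih' (h.length_eq ▸ hlen) hP hcs)

lemma exists_threshold {M q : ℕ} {cs : List ℕ} (hcs : ∀ c ∈ cs, c ≤ M) (hq : q ≤ cs.length) :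
    ∃ θ ≤ M, cs.countP (θ < ·) ≤ q ∧ q ≤ cs.countP (θ ≤ ·) := by
  have hex : ∃ θ, cs.countP (θ < ·) ≤ q := ⟨M, by
    rw [List.countP_eq_zero.2 (by simpa using hcs)]
    exact Nat.zero_le q⟩
  have hle : Nat.find hex ≤ M := Nat.find_le (by
    rw [List.countP_eq_zero.2 (by simpa using hcs)]
    exact Nat.zero_le q)
  refine ⟨Nat.find hex, hle, Nat.find_spec hex, ?_⟩
  rcases h : Nat.find hex with _ | θ
  · simpa using hq
  · have := Nat.find_min hex (m := θ) (by omega)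
    exact (not_le.1 this).le

lemma exists_signs (θ : ℕ) (cs : List ℕ) {q : ℕ} (h : cs.countP (θ < ·) ≤ q)
    (h' : q ≤ cs.countP (θ ≤ ·)) :
    ∃ bs : List Bool, bs.length = cs.length ∧ bs.count false = q ∧
      ∀ p ∈ bs.zip cs, bif p.1 then p.2 ≤ θ else θ ≤ p.2 := by
  induction cs generalizing q with
  | nil => exact ⟨[], by simp_all⟩
  | cons c cs ih =>
    have hmono : cs.countP (θ < ·) ≤ cs.countP (θ ≤ ·) :=
      List.countP_mono_left fun c _ hc => by simp at hc ⊢; omega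
    rw [List.countP_cons] at h h'
    simp only [decide_eq_true_eq] at h h'
    by_cases hfalse : θ < c ∨ θ = c ∧ cs.countP (θ ≤ ·) < q
    · obtain ⟨q, rfl⟩ : ∃ k, q = k + 1 := Nat.exists_eq_add_of_le' (by split_ifs at h h' <;> omega)
      obtain ⟨bs, h1, h2, h3⟩ := ih (q := q) (by split_ifs at h h' <;> omega)
        (by split_ifs at h h' <;> omega)
      refine ⟨false :: bs, by simpa using h1, by simpa using h2, ?_⟩
      rw [List.zip_cons_cons, List.forall_mem_cons]
      exact ⟨by simp; omega, h3⟩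
    · obtain ⟨bs, h1, h2, h3⟩ := ih (q := q) (by split_ifs at h h' <;> omega)
        (by split_ifs at h h' <;> omega)
      refine ⟨true :: bs, by simpa using h1, by simpa using h2, ?_⟩
      rw [List.zip_cons_cons, List.forall_mem_cons]
      exact ⟨by simp; omega, h3⟩

lemma weight_act_build {s t : S} (hst : s ≠ t) {M θ : ℕ} (hM2 : 2 ≤ M) {R : List (Bool × ℕ)}
    (hR : ValidRuns M R) (hθ : ∀ p ∈ R, bif p.1 then p.2 ≤ θ else θ ≤ p.2) (L : List ℕ)
    (x : Bool) (B : ℤ) :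
    Stack.weight M θ (Stack.act M s (L, x, B) (build s t M x R)) =
      Stack.weight M θ (L, x, B) + (build s t M x R).length := by
  induction R generalizing L x B with
  | nil => simp [build]
  | cons p R ih =>
    obtain ⟨b, c⟩ := p
    obtain ⟨hc, hR'⟩ := List.forall_mem_cons.1 hR
    obtain ⟨hcθ, hθ'⟩ := List.forall_mem_cons.1 hθ
    have hcounter := counterWeight_add hM2 θ (B - M)
    rw [sub_add_cancel] at hcounter
    cases b
    · simp only [build, Stack.act_append, runLength, cond_false, Bool.not_false, Bool.xor_true,
        List.length_append, length_alt] at hc hcθ ⊢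
      rw [Stack.act_alt_negative hst L B x (by omega) (by omega), ih hR' hθ']
      simp only [Stack.weight, List.map_cons, List.sum_cons, hcounter, runWeight]
      rw [min_eq_right (by omega)]
      push_cast
      omega
    · simp only [build, Stack.act_append, runLength, cond_true, Bool.not_true, Bool.xor_false,
        List.length_append, length_alt] at hc hcθ ⊢
      rw [Stack.act_alt_positive hst L B x (by omega) (by omega), ih hR' hθ']
      simp only [Stack.weight, List.map_cons, List.sum_cons, runWeight]
      rw [min_eq_left (by omega)]
      push_cast
      omega

lemma geodesic_build (A : ArtinData S) {s t : S} (hst : s ≠ t) (hdih : ∀ x : S, x = s ∨ x = t)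
    {M θ : ℕ} (hM : A.m s t = M) (hM2 : 2 ≤ M) (hθM : θ ≤ M) {R : List (Bool × ℕ)}
    (hR : ValidRuns M R) (hθ : ∀ p ∈ R, bif p.1 then p.2 ≤ θ else θ ≤ p.2) (x : Bool) :
    Geodesic A (build s t M x R) := by
  intro w' h
  have hx : Stack.Valid M ([], x, 0) := by simp [Stack.Valid]
  have h1 := weight_act_build hst hM2 hR hθ [] x 0
  have h2 := hx.weight_act_le hM2 (θ := θ) (by omega) (by omega) s w'
  rw [Stack.act_eq_of_wbar_eq A hst hdih hM h hx] at h2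
  omega

/-- A sequence of runs can be transformed into a geodesic word. -/
lemma exists_geodesic_of_build (A : ArtinData S) {s t : S} (hst : s ≠ t)
    (hdih : ∀ x : S, x = s ∨ x = t) {M : ℕ} (hM : A.m s t = M) (hM2 : 2 ≤ M)
    {R : List (Bool × ℕ)} (hR : ValidRuns M R) (x : Bool) :
    ∃ w', Geodesic A w' ∧ Steps012Star A (build s t M x R) w' := by
  obtain ⟨bs, cs, hlen, rfl⟩ : ∃ (bs : List Bool) (cs : List ℕ), bs.length = cs.length ∧
      R = bs.zip cs := ⟨R.map Prod.fst, R.map Prod.snd, by simp, List.zip_of_prod rfl rfl⟩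
  have hcs : ∀ c ∈ cs, 1 ≤ c ∧ c < M := by
    intro c hc
    rw [← List.map_snd_zip hlen.ge, List.mem_map] at hc
    obtain ⟨p, hp, rfl⟩ := hc
    exact hR p hp
  obtain ⟨θ, hθM, h, h'⟩ := exists_threshold (M := M) (q := bs.count false)
    (fun c hc => (hcs c hc).2.le) (hlen ▸ List.count_le_length)
  obtain ⟨bs', hlen', hcount, hθ⟩ := exists_signs θ cs h h'
  have hperm : bs ~ bs' := by
    have h1 := List.count_false_add_count_true bs
    have h2 := List.count_false_add_count_true bs'
    rw [List.perm_iff_count]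
    rintro (_ | _) <;> omega
  exact ⟨_, geodesic_build A hst hdih hM hM2 hθM (validRuns_zip hcs) hθ x,
    steps012Star_build_of_perm A hst hdih hM x hperm (P := []) hlen (by simp [ValidRuns]) hcs⟩

/-! ### Splitting a word into runs -/

lemma build_cons_letter (s t : S) {M : ℕ} (hM2 : 2 ≤ M) (x b : Bool) (R : List (Bool × ℕ)) :
    build s t M x ((b, runLength M b 1) :: R) = (gen s t (x ^^ !b), b) :: build s t M x R := by
  simp [build, runLength_runLength (show 1 ≤ M by omega), alt]

/-- A word which neither allows a transformation of type `0` nor contains a Garside factor is a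
sequence of runs. -/
lemma exists_step0_or_factor_or_build {s t : S} (hdih : ∀ x : S, x = s ∨ x = t) {M : ℕ}
    (hM2 : 2 ≤ M) (w : Word S) :
    (∃ w', Step0 w w') ∨ (∃ w₁ w₂ z b, w = w₁ ++ (alt s t z b M ++ w₂)) ∨
      ∃ x R, ValidRuns M R ∧ w = build s t M x R := by
  induction w with
  | nil => exact .inr (.inr ⟨true, [], by simp [ValidRuns], rfl⟩)
  | cons a w ih =>
    have hone (b : Bool) : 1 ≤ runLength M b 1 ∧ runLength M b 1 < M := by
      cases b <;> simp [runLength] <;> omega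
    obtain ⟨y, b⟩ := a
    obtain ⟨z, rfl⟩ := exists_gen hdih y
    rcases ih with ⟨w', w₁, w₂, y, b', rfl, rfl⟩ | ⟨w₁, w₂, z', b', rfl⟩ | ⟨x, R, hR, rfl⟩
    · exact .inl ⟨_, (gen s t z, b) :: w₁, w₂, y, b', rfl, rfl⟩
    · exact .inr (.inl ⟨(gen s t z, b) :: w₁, w₂, z', b', rfl⟩)
    · by_cases hz : z = (x ^^ !b)
      · subst hz
        exact .inr (.inr ⟨x, _, hR.cons (hone b), (build_cons_letter s t hM2 x b R).symm⟩)
      rcases R with _ | ⟨⟨b', c⟩, R⟩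
      · refine .inr (.inr ⟨z ^^ !b, [(b, runLength M b 1)], hR.cons (hone b), ?_⟩)
        rw [build_cons_letter s t hM2]
        simp [build]
      obtain ⟨n, hn⟩ := Nat.exists_eq_add_of_le' (hR.runLength_pos (List.mem_cons_self)).1
      have hnM := (hR.runLength_pos (List.mem_cons_self)).2
      have hR' : ValidRuns M R := fun p hp => hR p (List.mem_cons_of_mem _ hp)
      rw [build, hn]
      by_cases hb : b' = b
      · subst hb
        obtain rfl : z = (!x ^^ !b') := by cases z <;> cases x <;> cases b' <;> simp_all
        rw [hn] at hnM
        have hcons : (gen s t (!x ^^ !b'), b') :: (alt s t (x ^^ !b') b' (n + 1) ++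
            build s t M (x ^^ !(n + 1).bodd) R) = alt s t (!x ^^ !b') b' (n + 1 + 1) ++
              build s t M (!x ^^ !(n + 1 + 1).bodd) R := by
          have : (!(!x ^^ !b')) = (x ^^ !b') := by cases x <;> cases b' <;> rfl
          rw [show alt s t (!x ^^ !b') b' (n + 1 + 1) = (gen s t (!x ^^ !b'), b') ::
            alt s t (!(!x ^^ !b')) b' (n + 1) from rfl, this]
          cases x <;> cases n.bodd <;> simp
        rw [hcons]
        rcases Nat.eq_or_lt_of_le hnM with hnM | hnM
        · exact .inr (.inl ⟨[], _, !x ^^ !b', b', by rw [← hnM]; rfl⟩)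
        · refine .inr (.inr ⟨!x, (b', runLength M b' (n + 1 + 1)) :: R, hR'.cons ?_, ?_⟩)
          · cases b' <;> simp [runLength] <;> omega
          · rw [build, runLength_runLength hnM.le]
      · obtain rfl : b' = !b := by cases b <;> cases b' <;> simp_all
        obtain rfl : z = (x ^^ !!b) := by cases z <;> cases x <;> cases b <;> simp_all
        exact .inl ⟨_, [], _, _, _, rfl, rfl⟩

/-! ### Shortening words with a Garside factor -/

lemma steps012Star_switch (A : ArtinData S) {s t : S} (hst : s ≠ t)
    (hdih : ∀ x : S, x = s ∨ x = t) {M : ℕ} (hM : A.m s t = M) (w₁ w₂ : Word S) (z z' b : Bool) :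
    Steps012Star A (w₁ ++ (alt s t z b M ++ w₂)) (w₁ ++ (alt s t z' b M ++ w₂)) := by
  by_cases hz : z' = z
  · subst hz
    exact .refl
  obtain rfl : z' = !z := by cases z <;> cases z' <;> simp_all
  refine .single (.inr (.inl ?_))
  cases b
  · refine ⟨w₁, w₂, alt s t (!z ^^ !M.bodd) true M, alt s t (z ^^ !M.bodd) true M,
      (isRel_iff_alt A hst hdih hM).2 ⟨!z ^^ !M.bodd, rfl, ?_⟩, .inr ?_⟩
    · cases z <;> cases M.bodd <;> rfl
    · simp [wordInv_alt]
  · exact ⟨w₁, w₂, alt s t (!z) true M, alt s t z true M,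
      (isRel_iff_alt A hst hdih hM).2 ⟨!z, rfl, by simp⟩, .inl (by simp)⟩

lemma exists_shorter_of_mem_right (A : ArtinData S) {s t : S} (hst : s ≠ t)
    (hdih : ∀ x : S, x = s ∨ x = t) {k : ℕ} (hM : A.m s t = (k + 1 : ℕ)) {b : Bool}
    {w₂ : Word S} (h : ∃ a ∈ w₂, a.2 = !b) (w₁ : Word S) (z : Bool) :
    ∃ w', Steps012Star A (w₁ ++ (alt s t z b (k + 1) ++ w₂)) w' ∧
      w'.length < (w₁ ++ (alt s t z b (k + 1) ++ w₂)).length := by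
  induction w₂ generalizing w₁ z with
  | nil => simp at h
  | cons a w₂ ih =>
    obtain ⟨y, c⟩ := a
    obtain ⟨y, rfl⟩ := exists_gen hdih y
    by_cases hc : c = b
    · subst hc
      have hswitch := steps012Star_switch A hst hdih hM w₁ ((gen s t y, c) :: w₂) z
        (y ^^ (k + 1).bodd) c
      have hmove : alt s t (y ^^ (k + 1).bodd) c (k + 1) ++ (gen s t y, c) :: w₂ =
          [(gen s t (y ^^ (k + 1).bodd), c)] ++
            (alt s t (!(y ^^ (k + 1).bodd)) c (k + 1) ++ w₂) := by
        have := alt_succ_concat s t (y ^^ (k + 1).bodd) c (k + 1)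
        rw [Bool.xor_assoc, Bool.xor_self, Bool.xor_false] at this
        simpa [alt] using (congrArg (· ++ w₂) this).symm
      rw [hmove, ← List.append_assoc w₁ [_]] at hswitch
      obtain ⟨w', h1, h2⟩ := ih (by simpa using h) (w₁ ++ [(gen s t (y ^^ (k + 1).bodd), c)])
        (!(y ^^ (k + 1).bodd))
      refine ⟨w', hswitch.trans h1, h2.trans_eq ?_⟩
      simp; omega
    · obtain rfl : c = !b := by cases b <;> cases c <;> simp_all
      refine ⟨w₁ ++ alt s t (y ^^ k.bodd) b k ++ w₂, (steps012Star_switch A hst hdih hM w₁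
        ((gen s t y, !b) :: w₂) z (y ^^ k.bodd) b).tail (.inl ?_), ?_⟩
      · refine ⟨w₁ ++ alt s t (y ^^ k.bodd) b k, w₂, gen s t y, b, ?_, rfl⟩
        simp [alt_succ_concat]
      · simp; omega

lemma exists_shorter_of_mem_left (A : ArtinData S) {s t : S} (hst : s ≠ t)
    (hdih : ∀ x : S, x = s ∨ x = t) {k : ℕ} (hM : A.m s t = (k + 1 : ℕ)) {b : Bool}
    {w₁ : Word S} (h : ∃ a ∈ w₁, a.2 = !b) (w₂ : Word S) (z : Bool) :
    ∃ w', Steps012Star A (w₁ ++ (alt s t z b (k + 1) ++ w₂)) w' ∧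
      w'.length < (w₁ ++ (alt s t z b (k + 1) ++ w₂)).length := by
  induction w₁ using List.reverseRecOn generalizing w₂ z with
  | nil => simp at h
  | append_singleton w₁ a ih =>
    obtain ⟨y, c⟩ := a
    obtain ⟨y, rfl⟩ := exists_gen hdih y
    by_cases hc : c = b
    · subst hc
      have hswitch := steps012Star_switch A hst hdih hM (w₁ ++ [(gen s t y, c)]) w₂ z (!y) c
      have hmove : (gen s t y, c) :: alt s t (!y) c (k + 1) =
          alt s t y c (k + 1) ++ [(gen s t (y ^^ (k + 1).bodd), c)] :=
        alt_succ_concat s t y c (k + 1)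
      have hmove' : w₁ ++ [(gen s t y, c)] ++ (alt s t (!y) c (k + 1) ++ w₂) =
          w₁ ++ (alt s t y c (k + 1) ++ (gen s t (y ^^ (k + 1).bodd), c) :: w₂) := by
        simpa using congrArg (w₁ ++ · ++ w₂) hmove
      rw [hmove'] at hswitch
      obtain ⟨w', h1, h2⟩ := ih (by simpa using h) ((gen s t (y ^^ (k + 1).bodd), c) :: w₂) y
      refine ⟨w', hswitch.trans h1, h2.trans_eq ?_⟩
      simp; omega
    · obtain rfl : c = !b := by cases b <;> cases c <;> simp_all
      refine ⟨w₁ ++ (alt s t (!y) b k ++ w₂), (steps012Star_switch A hst hdih hM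
        (w₁ ++ [(gen s t y, !b)]) w₂ z y b).tail (.inl ?_), ?_⟩
      · exact ⟨w₁, alt s t (!y) b k ++ w₂, gen s t y, !b, by simp [alt], rfl⟩
      · simp

/-! ### Geodesic words -/

lemma Step0.length_lt {w w' : Word S} (h : Step0 w w') : w'.length < w.length := by
  obtain ⟨w₁, w₂, s, b, rfl, rfl⟩ := h
  simp

lemma exists_geodesic_of_eq_coe (A : ArtinData S) {s t : S} (hst : s ≠ t)
    (hdih : ∀ x : S, x = s ∨ x = t) {M : ℕ} (hM : A.m s t = M) (w : Word S) :
    ∃ w', Geodesic A w' ∧ Steps012Star A w w' := by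
  have hM2 : 2 ≤ M := by
    have := A.two_le s t hst
    rw [hM] at this
    exact_mod_cast this
  induction hlen : w.length using Nat.strong_induction_on generalizing w with
  | _ n ih =>
    subst hlen
    have hshorter {w' : Word S} (hw : Steps012Star A w w') (hlt : w'.length < w.length) :
        ∃ w', Geodesic A w' ∧ Steps012Star A w w' := by
      obtain ⟨w'', h1, h2⟩ := ih _ hlt w' rfl
      exact ⟨w'', h1, hw.trans h2⟩
    rcases exists_step0_or_factor_or_build hdih hM2 w with ⟨w', h⟩ | ⟨w₁, w₂, z, b, rfl⟩ |
      ⟨x, R, hR, rfl⟩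
    · exact hshorter (.single (.inl h)) h.length_lt
    · obtain ⟨k, rfl⟩ := Nat.exists_eq_add_of_le' (show 1 ≤ M by omega)
      by_cases h₁ : ∃ a ∈ w₁, a.2 = !b
      · obtain ⟨w', h, hlt⟩ := exists_shorter_of_mem_left A hst hdih hM h₁ w₂ z
        exact hshorter h hlt
      by_cases h₂ : ∃ a ∈ w₂, a.2 = !b
      · obtain ⟨w', h, hlt⟩ := exists_shorter_of_mem_right A hst hdih hM h₂ w₁ z
        exact hshorter h hlt
      have halt : ∀ (n : ℕ) (z : Bool), ∀ a ∈ alt s t z b n, a.2 = b := by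
        intro n
        induction n with
        | zero => simp [alt]
        | succ n ih => exact fun z => List.forall_mem_cons.2 ⟨rfl, ih _⟩
      refine ⟨_, geodesic_of_signed A hst hdih hM hM2 (b := b) fun a ha => ?_, .refl⟩
      by_contra hab
      have hab' : a.2 = !b := by cases h : a.2 <;> cases b <;> simp_all
      rcases List.mem_append.1 ha with ha | ha
      · exact h₁ ⟨a, ha, hab'⟩
      rcases List.mem_append.1 ha with ha | ha
      · exact hab (halt _ _ a ha)
      · exact h₂ ⟨a, ha, hab'⟩
    · exact exists_geodesic_of_build A hst hdih hM hM2 hR x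

lemma exists_geodesic_of_eq_top (A : ArtinData S) {s t : S} (hdih : ∀ x : S, x = s ∨ x = t)
    (hM : A.m s t = ⊤) (w : Word S) : ∃ w', Geodesic A w' ∧ Steps012Star A w w' := by
  have hrels : ∀ r ∈ rels A, FreeGroup.lift FreeGroup.of r = 1 := by
    rintro _ ⟨u, v, ⟨x, y, k, hxy, hk, -⟩, -⟩
    rcases hdih x with rfl | rfl <;> rcases hdih y with rfl | rfl
    · exact absurd rfl hxy
    · rw [hM] at hk; simp at hk
    · rw [A.symm, hM] at hk; simp at hk
    · exact absurd rfl hxy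
  refine ⟨FreeGroup.reduce w, fun w' h => ?_, ?_⟩
  · have h := congrArg (PresentedGroup.toGroup hrels) h
    change FreeGroup.lift FreeGroup.of (FreeGroup.mk w') =
      FreeGroup.lift FreeGroup.of (FreeGroup.mk (FreeGroup.reduce w)) at h
    rw [FreeGroup.lift_of_eq_id, MonoidHom.id_apply, MonoidHom.id_apply,
      FreeGroup.reduce.self] at h
    rw [FreeGroup.reduce.sound h.symm]
    exact FreeGroup.norm_mk_le
  · refine Relation.ReflTransGen.mono ?_ w _ FreeGroup.reduce.red
    rintro _ _ ⟨⟩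
    exact .inl ⟨_, _, _, _, by simp; exact ⟨rfl, rfl⟩, rfl⟩

/-- Corollary 2.20: in a dihedral Artin–Tits group, every word can be
transformed by `→_{0,1,2⋆}` into a geodesic word representing the same element. -/
theorem stmt9 {S : Type*} [Finite S] (A : ArtinData S) (s t : S)
    (hst : s ≠ t) (hdih : ∀ x : S, x = s ∨ x = t) (w : Word S) :
    ∃ w' : Word S, Geodesic A w' ∧ wbar A w' = wbar A w ∧ Steps012Star A w w' := by
  obtain ⟨w', hw', h⟩ : ∃ w', Geodesic A w' ∧ Steps012Star A w w' := by
    cases hM : A.m s t with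
    | top => exact exists_geodesic_of_eq_top A hdih hM w
    | coe M => exact exists_geodesic_of_eq_coe A hst hdih hM w
  exact ⟨w', hw', h.wbar_eq, h⟩

end ArtinTits
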